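/- Equality of the static load multiplier and the kinematic functional under complementarity in the associative case: let B ∈ ℝ^{m×n}, N ∈ ℝ^{m×q}, C ∈ ℝ^{r×n}, D ∈ ℝ^{s×n} be real matrices, F^d, F^ℓ ∈ ℝ^n, and R_y ∈ ℝ. Suppose Bᵀ X + Dᵀ V + Cᵀ R = F^d + λ F^ℓ, B U = N β, D U = 0, U · F^ℓ = 1, and that the complementarity conditions β · (Nᵀ X) = 0 and (C U) · (R − R_y·𝟏) = 0 hold. Then λ = R_y·(𝟏 · (C U)) − U · F^d. -/

import Mathlib

open Matrix

/-- Equality of the static load multiplier and the kinematic functional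
under the complementarity conditions (associative case). -/
theorem static_kinematic_equality
    (m n q r s : ℕ)
    (B : Matrix (Fin m) (Fin n) ℝ) (Nm : Matrix (Fin m) (Fin q) ℝ)
    (C : Matrix (Fin r) (Fin n) ℝ) (D : Matrix (Fin s) (Fin n) ℝ)
    (Fd Fl : Fin n → ℝ) (Ry : ℝ)
    (lam : ℝ) (X : Fin m → ℝ) (V : Fin s → ℝ) (R : Fin r → ℝ)
    (U : Fin n → ℝ) (β : Fin q → ℝ)
    (heq : Bᵀ.mulVec X + Dᵀ.mulVec V + Cᵀ.mulVec R = Fd + lam • Fl)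
    (hBU : B.mulVec U = Nm.mulVec β)
    (hDU : D.mulVec U = 0)
    (hnorm : U ⬝ᵥ Fl = 1)
    (hcomp1 : β ⬝ᵥ Nmᵀ.mulVec X = 0)
    (hcomp2 : C.mulVec U ⬝ᵥ (R - Ry • (1 : Fin r → ℝ)) = 0) :
    lam = Ry * ((1 : Fin r → ℝ) ⬝ᵥ C.mulVec U) - U ⬝ᵥ Fd := by
  have hwork := congrArg (U ⬝ᵥ ·) heq
  simp only [dotProduct_add, dotProduct_smul, dotProduct_mulVec, vecMul_transpose, hBU, hDU,
    zero_dotProduct, hnorm, smul_eq_mul] at hwork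
  rw [dotProduct_mulVec, vecMul_transpose] at hcomp1
  rw [dotProduct_sub, dotProduct_smul, smul_eq_mul, dotProduct_comm _ 1] at hcomp2
  linarith
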